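/- Every poloid is isomorphic to a transformation poloid: for any poloid P there exist a transformation poloid T on the set P and a bijection α : P → T such that for all x, y ∈ P, xy is defined if and only if α(x)∘α(y) is defined, in which case α(xy) = α(x)∘α(y), and α maps units of P to units of T. -/

import Mathlib

/-- `e` is a unit of the partial magma `op`: `ex = x` whenever `ex` is defined and
`xe = x` whenever `xe` is defined. -/
def OIsUnit {M : Type*} (op : M → M → Option M) (e : M) : Prop :=
  (∀ x y, op e x = some y → y = x) ∧ (∀ x y, op x e = some y → y = x)

/-- A semigroupoid: whenever `xy` and `yz` are both defined, or `(xy)z` is defined,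
or `x(yz)` is defined, both `(xy)z` and `x(yz)` are defined and equal. -/
def IsSemigroupoid {M : Type*} (op : M → M → Option M) : Prop :=
  ∀ x y z : M,
    ((op x y).isSome ∧ (op y z).isSome) ∨
      ((op x y).bind (fun w => op w z)).isSome ∨
      ((op y z).bind (fun w => op x w)).isSome →
    ((op x y).bind (fun w => op w z)).isSome ∧
      (op x y).bind (fun w => op w z) = (op y z).bind (fun w => op x w)

/-- A poloid: a semigroupoid in which every element has an effective left unit and an
effective right unit. -/
def IsPoloid {M : Type*} (op : M → M → Option M) : Prop :=
  IsSemigroupoid op ∧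
    ∀ x : M, ∃ el er : M, OIsUnit op el ∧ OIsUnit op er ∧ (op el x).isSome ∧ (op x er).isSome

/-- Composite of partial functions on `X`: `(f ∘ g)(x) = f (g x)`. -/
def pcomp {X : Type*} (f g : X →. X) : X →. X := fun x => (g x).bind f

/-- `f ∘ g` is defined iff `Dom(f) ⊇ im(g)`. -/
def PComposable {X : Type*} (f g : X →. X) : Prop := g.ran ⊆ f.Dom

/-- A transformation on `X`: a partial function together with a codomain containing its image. -/
structure Tf (X : Type*) where
  toFun : X →. X
  cod : Set X
  ran_subset : toFun.ran ⊆ cod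

/-- `f ∘ g` is defined iff `Dom(f) ⊇ im(g)`. -/
def TfComposable {X : Type*} (f g : Tf X) : Prop := g.toFun.ran ⊆ f.toFun.Dom

/-- Composite of transformations: `Dom(f∘g) = Dom(g)` (when defined), `cod(f∘g) = cod(f)`,
`(f∘g)(x) = f(g(x))`. -/
def Tf.comp {X : Type*} (f g : Tf X) : Tf X where
  toFun := pcomp f.toFun g.toFun
  cod := f.cod
  ran_subset := by
    rintro y ⟨x, hx⟩
    simp only [pcomp] at hx
    rcases Part.mem_bind_iff.mp hx with ⟨z, hz, hfz⟩
    exact f.ran_subset ⟨z, hfz⟩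

/-- The identity transformation on `S ⊆ X`. -/
def IdTf {X : Type*} (S : Set X) : Tf X where
  toFun := fun x => ⟨x ∈ S, fun _ => x⟩
  cod := S
  ran_subset := by
    rintro y ⟨x, h, rfl⟩
    exact h

/-- A transformation magma on `X`: a set of transformations with nonempty domains,
closed under composition. -/
def IsTfMagma {X : Type*} (S : Set (Tf X)) : Prop :=
  (∀ f ∈ S, f.toFun.Dom.Nonempty) ∧
  ∀ f ∈ S, ∀ g ∈ S, TfComposable f g → Tf.comp f g ∈ S

/-- A transformation semigroupoid: a transformation magma in which
`Dom(f) ⊇ im(g)` implies `Dom(f) = cod(g)`. -/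
def IsTfSemigroupoid {X : Type*} (S : Set (Tf X)) : Prop :=
  IsTfMagma S ∧ ∀ f ∈ S, ∀ g ∈ S, g.toFun.ran ⊆ f.toFun.Dom → f.toFun.Dom = g.cod

/-- A transformation poloid: a transformation semigroupoid containing the identity
transformations on the domain and codomain of each of its members. -/
def IsTfPoloid {X : Type*} (S : Set (Tf X)) : Prop :=
  IsTfSemigroupoid S ∧ ∀ f ∈ S, IdTf f.toFun.Dom ∈ S ∧ IdTf f.cod ∈ S

/-- `e` is a unit of the transformation magma `S`. -/
def IsTfUnit {X : Type*} (S : Set (Tf X)) (e : Tf X) : Prop :=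
  (∀ g ∈ S, TfComposable e g → Tf.comp e g = g) ∧
  (∀ g ∈ S, TfComposable g e → Tf.comp g e = g)

theorem Tf.eq_of_mem_iff {X : Type*} {f g : Tf X}
    (h : ∀ x y, y ∈ f.toFun x ↔ y ∈ g.toFun x) (hc : ∀ x, x ∈ f.cod ↔ x ∈ g.cod) : f = g := by
  obtain ⟨f, c, hf⟩ := f
  obtain ⟨g, d, hg⟩ := g
  obtain rfl : f = g := PFun.ext h
  obtain rfl : c = d := Set.ext hc
  rfl

section Semigroupoid

variable {M : Type*} {op : M → M → Option M}

theorem IsSemigroupoid.assoc (h : IsSemigroupoid op) {x y z a b : M}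
    (hxy : op x y = some a) (hyz : op y z = some b) :
    ∃ c, op a z = some c ∧ op x b = some c := by
  have := h x y z (Or.inl ⟨by simp [hxy], by simp [hyz]⟩)
  simp only [hxy, hyz, Option.bind_some] at this
  obtain ⟨c, hc⟩ := Option.isSome_iff_exists.mp this.1
  exact ⟨c, hc, this.2 ▸ hc⟩

theorem IsSemigroupoid.assoc_of_left (h : IsSemigroupoid op) {x y z a c : M}
    (hxy : op x y = some a) (haz : op a z = some c) :
    ∃ b, op y z = some b ∧ op x b = some c := by
  have := h x y z (Or.inr (Or.inl (by simp [hxy, haz])))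
  simp only [hxy, haz, Option.bind_some] at this
  exact Option.bind_eq_some_iff.mp this.2.symm

theorem IsSemigroupoid.assoc_of_right (h : IsSemigroupoid op) {x y z b c : M}
    (hyz : op y z = some b) (hxb : op x b = some c) :
    ∃ a, op x y = some a ∧ op a z = some c := by
  have := h x y z (Or.inr (Or.inr (by simp [hyz, hxb])))
  simp only [hyz, hxb, Option.bind_some] at this
  exact Option.bind_eq_some_iff.mp this.2

/-- An effective left unit of an element is unique. -/
theorem IsSemigroupoid.left_unit_unique (h : IsSemigroupoid op) {e e' x : M}
    (he : OIsUnit op e) (he' : OIsUnit op e') (hx : op e x = some x) (hx' : op e' x = some x) :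
    e = e' := by
  obtain ⟨a, ha, -⟩ := h.assoc_of_right hx' hx
  exact (he'.2 _ _ ha).symm.trans (he.1 _ _ ha)

/-- If `xr = x` then `xt` is defined iff `rt` is defined. -/
theorem IsSemigroupoid.isSome_iff_of_right_unit (h : IsSemigroupoid op) {x r t : M}
    (hr : OIsUnit op r) (hx : op x r = some x) :
    (∃ y, op x t = some y) ↔ op r t = some t := by
  constructor
  · rintro ⟨y, hy⟩
    obtain ⟨b, hb, -⟩ := h.assoc_of_left hx hy
    rwa [hr.1 _ _ hb] at hb
  · intro ht
    obtain ⟨c, hc, -⟩ := h.assoc hx ht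
    exact ⟨c, hc⟩

theorem IsPoloid.exists_left_unit (h : IsPoloid op) (x : M) :
    ∃ e, OIsUnit op e ∧ op e x = some x := by
  obtain ⟨e, -, he, -, hx, -⟩ := h.2 x
  obtain ⟨y, hy⟩ := Option.isSome_iff_exists.mp hx
  exact ⟨e, he, by rwa [he.1 _ _ hy] at hy⟩

theorem IsPoloid.exists_right_unit (h : IsPoloid op) (x : M) :
    ∃ r, OIsUnit op r ∧ op x r = some x := by
  obtain ⟨-, r, -, hr, -, hx⟩ := h.2 x
  obtain ⟨y, hy⟩ := Option.isSome_iff_exists.mp hx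
  exact ⟨r, hr, by rwa [hr.2 _ _ hy] at hy⟩

theorem IsPoloid.unit_mul_self (h : IsPoloid op) {e : M} (he : OIsUnit op e) :
    op e e = some e := by
  obtain ⟨f, -, hfe⟩ := h.exists_left_unit e
  have : e = f := he.2 _ _ hfe
  rwa [← this] at hfe

/-- Left translation by `x`, with codomain the elements which admit the effective left unit
of `x` as a left factor. -/
def leftTranslation (op : M → M → Option M) (x : M) : Tf M where
  toFun := fun t => Part.ofOption (op x t)
  cod := {t | (∃ y, op x y = some t) ∨ ∃ e, OIsUnit op e ∧ op e x = some x ∧ op e t = some t}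
  ran_subset := by
    rintro y ⟨t, ht⟩
    exact Or.inl ⟨t, Part.mem_ofOption.mp ht⟩

theorem mem_leftTranslation {x t y : M} :
    y ∈ (leftTranslation op x).toFun t ↔ op x t = some y :=
  Part.mem_ofOption

theorem mem_dom_leftTranslation {x t : M} :
    t ∈ (leftTranslation op x).toFun.Dom ↔ ∃ y, op x t = some y :=
  Part.dom_iff_mem.trans (exists_congr fun _ => mem_leftTranslation)

theorem mem_cod_leftTranslation (h : IsPoloid op) {x e t : M} (he : OIsUnit op e) (hx : op e x = some x) :
    t ∈ (leftTranslation op x).cod ↔ op e t = some t := by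
  constructor
  · rintro (⟨y, hy⟩ | ⟨f, hf, hfx, hft⟩)
    · obtain ⟨c, hc, hc'⟩ := h.1.assoc hx hy
      rwa [he.1 _ _ hc'] at hc'
    · rwa [h.1.left_unit_unique he hf hx hfx]
  · exact fun ht => Or.inr ⟨e, he, hx, ht⟩

theorem tfComposable_leftTranslation (h : IsPoloid op) {x y : M} :
    TfComposable (leftTranslation op x) (leftTranslation op y) ↔
      ∃ z, op x y = some z := by
  constructor
  · intro hc
    obtain ⟨r, -, hr⟩ := h.exists_right_unit y
    exact mem_dom_leftTranslation.mp (hc ⟨r, mem_leftTranslation.mpr hr⟩)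
  · rintro ⟨z, hz⟩ w ⟨t, ht⟩
    obtain ⟨c, -, hc⟩ := h.1.assoc hz (mem_leftTranslation.mp ht)
    exact mem_dom_leftTranslation.mpr ⟨c, hc⟩

theorem leftTranslation_mul (h : IsPoloid op) {x y z : M} (hz : op x y = some z) :
    leftTranslation op z =
      Tf.comp (leftTranslation op x) (leftTranslation op y) := by
  apply Tf.eq_of_mem_iff
  · intro t w
    refine mem_leftTranslation.trans (Iff.trans ?_ Part.mem_bind_iff.symm)
    simp only [mem_leftTranslation]
    constructor
    · exact fun hw => h.1.assoc_of_left hz hw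
    · rintro ⟨b, hb, hw⟩
      obtain ⟨c, hc, hc'⟩ := h.1.assoc hz hb
      rwa [hc', ← hc] at hw
  · intro t
    obtain ⟨e, he, hx⟩ := h.exists_left_unit x
    obtain ⟨c, hc, hc'⟩ := h.1.assoc hx hz
    rw [he.1 _ _ hc'] at hc'
    exact (mem_cod_leftTranslation h he hc').trans (mem_cod_leftTranslation h he hx).symm

theorem leftTranslation_injective (h : IsPoloid op) : Function.Injective (leftTranslation op) := by
  intro x y hxy
  obtain ⟨r, hr, hx⟩ := h.exists_right_unit x
  rw [← mem_leftTranslation, hxy, mem_leftTranslation] at hx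
  exact hr.2 _ _ hx

theorem leftTranslation_unit (h : IsPoloid op) {e : M} {S : Set M} (he : OIsUnit op e)
    (hS : ∀ t, t ∈ S ↔ op e t = some t) : leftTranslation op e = IdTf S := by
  apply Tf.eq_of_mem_iff
  · intro t w
    rw [mem_leftTranslation]
    constructor
    · intro hw
      obtain rfl := he.1 _ _ hw
      exact ⟨(hS w).mpr hw, rfl⟩
    · rintro ⟨ht, rfl⟩
      exact (hS t).mp ht
  · exact fun t => (mem_cod_leftTranslation h he (h.unit_mul_self he)).trans (hS t).symm

theorem dom_leftTranslation_eq_cod (h : IsPoloid op) {x y z : M} (hz : op x y = some z) :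
    (leftTranslation op x).toFun.Dom = (leftTranslation op y).cod := by
  ext t
  obtain ⟨e, he, hy⟩ := h.exists_left_unit y
  obtain ⟨a, ha, -⟩ := h.1.assoc_of_right hy hz
  rw [he.2 _ _ ha] at ha
  rw [mem_dom_leftTranslation, mem_cod_leftTranslation h he hy,
    h.1.isSome_iff_of_right_unit he ha]

theorem isTfPoloid_range_leftTranslation (h : IsPoloid op) :
    IsTfPoloid (Set.range (leftTranslation op)) := by
  refine ⟨⟨⟨?_, ?_⟩, ?_⟩, ?_⟩
  · rintro _ ⟨x, rfl⟩
    obtain ⟨r, -, hr⟩ := h.exists_right_unit x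
    exact ⟨r, mem_dom_leftTranslation.mpr ⟨x, hr⟩⟩
  · rintro _ ⟨x, rfl⟩ _ ⟨y, rfl⟩ hc
    obtain ⟨z, hz⟩ := (tfComposable_leftTranslation h).mp hc
    exact ⟨z, leftTranslation_mul h hz⟩
  · rintro _ ⟨x, rfl⟩ _ ⟨y, rfl⟩ hc
    obtain ⟨z, hz⟩ := (tfComposable_leftTranslation h).mp hc
    exact dom_leftTranslation_eq_cod h hz
  · rintro _ ⟨x, rfl⟩
    obtain ⟨r, hr, hxr⟩ := h.exists_right_unit x
    obtain ⟨e, he, hex⟩ := h.exists_left_unit x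
    exact ⟨⟨r, leftTranslation_unit h hr fun t =>
        mem_dom_leftTranslation.trans (h.1.isSome_iff_of_right_unit hr hxr)⟩,
      ⟨e, leftTranslation_unit h he fun t => mem_cod_leftTranslation h he hex⟩⟩

theorem isTfUnit_leftTranslation (h : IsPoloid op) {e : M} (he : OIsUnit op e) :
    IsTfUnit (Set.range (leftTranslation op)) (leftTranslation op e) := by
  constructor
  · rintro _ ⟨x, rfl⟩ hc
    obtain ⟨z, hz⟩ := (tfComposable_leftTranslation h).mp hc
    rw [← leftTranslation_mul h hz, he.1 _ _ hz]
  · rintro _ ⟨x, rfl⟩ hc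
    obtain ⟨z, hz⟩ := (tfComposable_leftTranslation h).mp hc
    rw [← leftTranslation_mul h hz, he.2 _ _ hz]

end Semigroupoid

/-- Every poloid is isomorphic to a transformation poloid on its own underlying set. -/
theorem stmt16 {M : Type*} (op : M → M → Option M) (hP : IsPoloid op) :
    ∃ (T : Set (Tf M)) (α : M → Tf M),
      IsTfPoloid T ∧
      (∀ x : M, α x ∈ T) ∧
      Function.Injective α ∧
      (∀ f ∈ T, ∃ x : M, α x = f) ∧
      (∀ x y : M, (op x y).isSome ↔ TfComposable (α x) (α y)) ∧
      (∀ x y z : M, op x y = some z → α z = Tf.comp (α x) (α y)) ∧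
      (∀ e : M, OIsUnit op e → IsTfUnit T (α e)) := by
  exact ⟨Set.range (leftTranslation op), leftTranslation op,
    isTfPoloid_range_leftTranslation hP, Set.mem_range_self, leftTranslation_injective hP,
    fun _ hf => hf,
    fun _ _ => Option.isSome_iff_exists.trans (tfComposable_leftTranslation hP).symm,
    fun _ _ _ hz => leftTranslation_mul hP hz, fun _ he => isTfUnit_leftTranslation hP he⟩
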